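/- There is a constant c > 0 such that for every prime p and every finite p-group G of order greater than p^{p^p} (so that the iterated base-p logarithms below are positive), k(G) > c·log_p|G|·(log_p log_p|G|)/(log_p log_p log_p|G|). -/

import Mathlib

namespace PGrp

set_option linter.style.haveILetI false

section Additive
variable {V W : Type*} [AddCommGroup V] [AddCommGroup W]

lemma card_eq_inf_ker_mul_map (S : AddSubgroup V) (f : V →+ W) :
    Nat.card S = Nat.card (S ⊓ f.ker : AddSubgroup V) * Nat.card (S.map f) := by
  have h1 := AddSubgroup.card_mul_index (f.comp S.subtype).ker
  rw [AddSubgroup.index_ker] at h1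
  rw [← h1]
  congr 1
  · refine Nat.card_congr ⟨fun x => ⟨x.1.1, x.1.2, x.2⟩, fun x => ⟨⟨x.1, x.2.1⟩, x.2.2⟩, ?_, ?_⟩
    · intro x; rfl
    · intro x; rfl
  · have : (f.comp S.subtype).range = S.map f := by
      ext y
      simp only [AddMonoidHom.mem_range, AddSubgroup.mem_map]
      constructor
      · rintro ⟨x, rfl⟩; exact ⟨x.1, x.2, rfl⟩
      · rintro ⟨x, hx, rfl⟩; exact ⟨⟨x, hx⟩, rfl⟩
    rw [this]

lemma card_le_of_le' [Finite V] {S T : AddSubgroup V} (h : S ≤ T) : Nat.card S ≤ Nat.card T :=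
  Nat.card_mono (Set.toFinite _) h

lemma card_ker_comp_le [Finite V] (f g : V →+ V) :
    Nat.card (f.comp g).ker ≤ Nat.card f.ker * Nat.card g.ker := by
  rw [card_eq_inf_ker_mul_map (f.comp g).ker g, mul_comm]
  apply Nat.mul_le_mul
  · apply card_le_of_le'
    rintro _ ⟨x, hx, rfl⟩
    exact hx
  · exact card_le_of_le' inf_le_right

lemma card_ker_pow_le [Finite V] (f : AddMonoid.End V) (n : ℕ) :
    Nat.card (AddMonoidHom.ker (f ^ n : AddMonoid.End V)) ≤ Nat.card (AddMonoidHom.ker f) ^ n := by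
  induction n with
  | zero =>
    have : AddMonoidHom.ker (f ^ 0 : AddMonoid.End V) = ⊥ := by
      rw [eq_bot_iff]
      intro x hx
      exact hx
    rw [this]; simp
  | succ n ih =>
    rw [pow_succ, pow_succ]
    exact (card_ker_comp_le (f ^ n : AddMonoid.End V) f).trans (Nat.mul_le_mul_right _ ih)

/-- multiplication by `m` -/
def mulE (V : Type*) [AddCommGroup V] (m : ℕ) : V →+ V := nsmulAddMonoidHom m

@[simp] lemma mem_ker_mulE (m : ℕ) (v : V) : v ∈ (mulE V m).ker ↔ m • v = 0 := Iff.rfl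

lemma unip {p : ℕ} (hp : p.Prime) (f : ℕ) (φ : AddMonoid.End V) (h : φ ^ p ^ f = 1)
    (v : V) (hv : p • v = 0) : ((φ - 1) ^ p ^ f : AddMonoid.End V) v = 0 := by
  have hc : Commute (φ - 1) (1 : AddMonoid.End V) := Commute.one_right _
  have h2 := hc.add_pow_prime_pow_eq' hp f
  rw [sub_add_cancel, h, one_pow] at h2
  set r := ∑ k ∈ Finset.Ioo 0 (p ^ f), (φ - 1) ^ k * 1 ^ (p ^ f - k) * (((p ^ f).choose k / p : ℕ) : AddMonoid.End V) with hr
  have h3 : (φ - 1) ^ p ^ f + (p : AddMonoid.End V) * r = 0 := by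
    have : (1 : AddMonoid.End V) = (φ - 1) ^ p ^ f + (p : AddMonoid.End V) * r + 1 := by
      conv_lhs => rw [h2]
      abel
    simpa using this
  have h4 := congrArg (fun g : AddMonoid.End V => g v) h3
  have h5 : ((p : AddMonoid.End V) * r) v = 0 := by
    rw [(Nat.cast_commute p r).eq]
    change r ((p : AddMonoid.End V) v) = 0
    rw [AddMonoid.End.natCast_apply, hv, map_zero]
  have h6 : ((φ - 1) ^ p ^ f : AddMonoid.End V) v + ((p : AddMonoid.End V) * r) v = 0 := h4
  rwa [h5, add_zero] at h6

/-- fixed points of an endomorphism -/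
def fixE (φ : AddMonoid.End V) : AddSubgroup V where
  carrier := {v | φ v = v}
  zero_mem' := map_zero φ
  add_mem' := by
    intro a b (ha : φ a = a) (hb : φ b = b)
    change φ (a + b) = a + b
    rw [map_add, ha, hb]
  neg_mem' := by
    intro a (ha : φ a = a)
    change φ (-a) = -a
    rw [map_neg, ha]

lemma mem_fixE {φ : AddMonoid.End V} {v : V} : v ∈ fixE φ ↔ φ v = v := Iff.rfl

lemma fixE_eq (φ : AddMonoid.End V) : AddMonoidHom.ker (φ - 1) = fixE φ := by
  ext v
  change φ v - v = 0 ↔ _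
  exact sub_eq_zero

lemma tors_le_fix_pow [Finite V] {p : ℕ} (hp : p.Prime) (f : ℕ) (φ : AddMonoid.End V)
    (h : φ ^ p ^ f = 1) :
    Nat.card (mulE V p).ker ≤ Nat.card (fixE φ) ^ p ^ f := by
  rw [← fixE_eq]
  refine le_trans (card_le_of_le' ?_) (card_ker_pow_le (φ - 1) (p ^ f))
  intro v hv
  exact unip hp f φ h v hv

lemma card_tors_pow_le [Finite V] (p F : ℕ) :
    Nat.card (mulE V (p ^ F)).ker ≤ Nat.card (mulE V p).ker ^ F := by
  set m : AddMonoid.End V := mulE V p with hm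
  refine le_trans (card_le_of_le' ?_) (card_ker_pow_le m F)
  intro v hv
  have key : ∀ n : ℕ, ∀ v, (m ^ n) v = p ^ n • v := by
    intro n
    induction n with
    | zero => intro v; simp
    | succ n ih =>
      intro v
      rw [pow_succ, pow_succ, mul_smul]
      change (m ^ n) (p • v) = _
      rw [ih]
  change (m ^ F) v = 0
  rw [key]; exact hv

/-- If `B` has an element not killed by `p^(2e)` then `p^e |B[p^e]| ≤ |B[p^(2e)]|`. -/
lemma tors_growth [Finite V] {p : ℕ} (hp : p.Prime) (B : AddSubgroup V) (e k : ℕ)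
    (hk : Nat.card V = p ^ k)
    (z : V) (hzB : z ∈ B) (hz : p ^ (2 * e) • z ≠ 0) :
    p ^ e * Nat.card (B ⊓ (mulE V (p ^ e)).ker : AddSubgroup V) ≤
      Nat.card (B ⊓ (mulE V (p ^ (2 * e))).ker : AddSubgroup V) := by
  obtain ⟨s, -, hs⟩ : ∃ s ≤ k, addOrderOf z = p ^ s := by
    have : addOrderOf z ∣ p ^ k := hk ▸ addOrderOf_dvd_natCard z
    exact (Nat.dvd_prime_pow hp).1 this
  have hs2 : 2 * e ≤ s := by
    by_contra hlt
    apply hz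
    rw [← addOrderOf_dvd_iff_nsmul_eq_zero, hs]
    exact pow_dvd_pow _ (by omega)
  set w := p ^ (s - e) • z with hw
  have hordw : addOrderOf w = p ^ e := by
    rw [hw, addOrderOf_nsmul' z (pow_pos hp.pos _).ne', hs,
      Nat.gcd_eq_right (pow_dvd_pow _ (by omega)), Nat.pow_div (by omega) hp.pos]
    congr 1; omega
  rw [card_eq_inf_ker_mul_map (B ⊓ (mulE V (p ^ (2 * e))).ker) (mulE V (p ^ e)), mul_comm]
  apply Nat.mul_le_mul
  · apply card_le_of_le'
    rintro v ⟨h1, h2⟩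
    refine ⟨⟨h1, ?_⟩, h2⟩
    change p ^ (2 * e) • v = 0
    have h2' : p ^ e • v = 0 := h2
    rw [two_mul, pow_add, mul_smul, h2', smul_zero]
  · have hcz : p ^ e = Nat.card (AddSubgroup.zmultiples w) := by
      rw [Nat.card_zmultiples, hordw]
    refine hcz.le.trans (card_le_of_le' ?_)
    rw [AddSubgroup.zmultiples_le]
    refine ⟨p ^ (s - 2 * e) • z, ⟨B.nsmul_mem hzB _, ?_⟩, ?_⟩
    · change p ^ (2 * e) • (p ^ (s - 2 * e) • z) = 0
      rw [smul_smul, ← pow_add, ← addOrderOf_dvd_iff_nsmul_eq_zero, hs]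
      exact pow_dvd_pow _ (by omega)
    · change p ^ e • (p ^ (s - 2 * e) • z) = w
      rw [smul_smul, ← pow_add, hw]
      congr 2; omega

lemma trace_lemma [Finite V] {p : ℕ} (hp : p.Prime) (e k : ℕ) (hk : Nat.card V = p ^ k)
    (φ : AddMonoid.End V) (h : φ ^ p ^ e = 1)
    (y : V) (hy : y ∈ fixE φ) (hyr : y ∈ (mulE V (p ^ (2 * e))).range)
    (hy0 : p ^ e • y ≠ 0) :
    p ^ e * Nat.card (fixE φ ⊓ (mulE V (p ^ (2 * e))).range : AddSubgroup V) ≤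
      Nat.card (fixE φ) := by
  set B : AddSubgroup V := fixE φ with hB
  have hBm : ∀ v, v ∈ B ↔ φ v = v := by
    intro v
    exact Iff.rfl
  have hfix : ∀ v, φ v = v → ∀ j : ℕ, (φ ^ j : AddMonoid.End V) v = v := by
    intro v hv j
    induction j with
    | zero => rfl
    | succ j ih =>
      rw [pow_succ]
      change (φ ^ j : AddMonoid.End V) (φ v) = v
      rw [hv, ih]
  have key : ∀ v ∈ B, v ∈ (mulE V (p ^ (2 * e))).range →
      ∃ z ∈ B, p ^ (2 * e) • z = p ^ e • v := by
    rintro v hv ⟨v', rfl⟩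
    change p ^ (2 * e) • v' ∈ B at hv
    refine ⟨∑ j ∈ Finset.range (p ^ e), (φ ^ j : AddMonoid.End V) v', ?_, ?_⟩
    · rw [hBm, map_sum]
      have h1 : ∀ j, φ ((φ ^ j : AddMonoid.End V) v') = (φ ^ (j + 1) : AddMonoid.End V) v' := by
        intro j; rw [pow_succ']; rfl
      simp_rw [h1]
      have h2 := Finset.sum_range_succ (fun j => (φ ^ j : AddMonoid.End V) v') (p ^ e)
      rw [Finset.sum_range_succ', h] at h2
      simpa using h2
    · rw [Finset.smul_sum]
      have h1 : ∀ j, p ^ (2 * e) • (φ ^ j : AddMonoid.End V) v' = p ^ (2 * e) • v' := by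
        intro j
        rw [← map_nsmul]
        exact hfix _ ((hBm _).1 hv) j
      simp_rw [h1]
      simp [mulE]
  obtain ⟨z, hzB, hz⟩ := key y hy hyr
  have hz0 : p ^ (2 * e) • z ≠ 0 := by rw [hz]; exact hy0
  have g := tors_growth hp B e k hk z hzB hz0
  rw [card_eq_inf_ker_mul_map B (mulE V (p ^ (2 * e))),
    card_eq_inf_ker_mul_map (B ⊓ (mulE V (p ^ (2 * e))).range) (mulE V (p ^ e)), ← mul_assoc]
  apply Nat.mul_le_mul
  · refine le_trans (Nat.mul_le_mul_left _ (card_le_of_le' ?_)) g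
    exact inf_le_inf_right _ inf_le_left
  · apply card_le_of_le'
    rintro _ ⟨v, ⟨hv1, hv2⟩, rfl⟩
    obtain ⟨z, hzB, hz⟩ := key v hv1 hv2
    exact ⟨z, hzB, hz⟩

end Additive

section Abelian
variable {H : Type} [Group H]

/-- elements of `Y` commuting with `x` -/
def cen (Y : Subgroup H) (x : H) : Subgroup H := Y ⊓ Subgroup.centralizer {x}

lemma mem_cen {Y : Subgroup H} {x y : H} : y ∈ cen Y x ↔ y ∈ Y ∧ x * y = y * x := by
  simp [cen, Subgroup.mem_centralizer_singleton_iff, eq_comm]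

/-- commuting elements -/
def Comm (A : Subgroup H) : Prop := ∀ a ∈ A, ∀ b ∈ A, a * b = b * a

/-- `m`-th powers of elements of `A` -/
def powS (A : Subgroup H) (hA : Comm A) (m : ℕ) : Subgroup H where
  carrier := {y | ∃ a ∈ A, a ^ m = y}
  one_mem' := ⟨1, A.one_mem, one_pow m⟩
  mul_mem' := by
    rintro _ _ ⟨a, ha, rfl⟩ ⟨b, hb, rfl⟩
    exact ⟨a * b, A.mul_mem ha hb, (show Commute a b from hA a ha b hb).mul_pow m⟩
  inv_mem' := by
    rintro _ ⟨a, ha, rfl⟩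
    exact ⟨a⁻¹, A.inv_mem ha, inv_pow a m⟩

/-- elements of `A` of order dividing `m` -/
def torsS (A : Subgroup H) (hA : Comm A) (m : ℕ) : Subgroup H where
  carrier := {y | y ∈ A ∧ y ^ m = 1}
  one_mem' := ⟨A.one_mem, one_pow m⟩
  mul_mem' := by
    rintro a b ⟨ha, ha'⟩ ⟨hb, hb'⟩
    refine ⟨A.mul_mem ha hb, ?_⟩
    rw [(show Commute a b from hA a ha b hb).mul_pow m, ha', hb', one_mul]
  inv_mem' := by
    rintro a ⟨ha, ha'⟩
    exact ⟨A.inv_mem ha, by rw [inv_pow, ha', inv_one]⟩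

lemma mem_powS {A : Subgroup H} {hA : Comm A} {m : ℕ} {y : H} :
    y ∈ powS A hA m ↔ ∃ a ∈ A, a ^ m = y := Iff.rfl

lemma mem_torsS {A : Subgroup H} {hA : Comm A} {m : ℕ} {y : H} :
    y ∈ torsS A hA m ↔ y ∈ A ∧ y ^ m = 1 := Iff.rfl

lemma powS_le {A : Subgroup H} {hA : Comm A} {m : ℕ} : powS A hA m ≤ A := by
  rintro _ ⟨a, ha, rfl⟩; exact A.pow_mem ha m

lemma torsS_le {A : Subgroup H} {hA : Comm A} {m : ℕ} : torsS A hA m ≤ A := fun _ h => h.1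

lemma Comm.mono {A B : Subgroup H} (hA : Comm A) (h : B ≤ A) : Comm B :=
  fun a ha b hb => hA a (h ha) b (h hb)

lemma powS_normal {A : Subgroup H} [hn : A.Normal] {hA : Comm A} {m : ℕ} :
    (powS A hA m).Normal := ⟨by
  rintro _ ⟨a, ha, rfl⟩ g
  exact ⟨g * a * g⁻¹, hn.conj_mem a ha g, conj_pow⟩⟩

lemma torsS_normal {A : Subgroup H} [hn : A.Normal] {hA : Comm A} {m : ℕ} :
    (torsS A hA m).Normal := ⟨by
  rintro a ⟨ha, ha'⟩ g
  exact ⟨hn.conj_mem a ha g, by rw [conj_pow, ha']; simp⟩⟩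

lemma powS_powS {A : Subgroup H} {hA : Comm A} {m k : ℕ} (h : Comm (powS A hA m)) :
    powS (powS A hA m) h k = powS A hA (m * k) := by
  ext y
  simp only [mem_powS]
  constructor
  · rintro ⟨_, ⟨a, ha, rfl⟩, rfl⟩
    exact ⟨a, ha, pow_mul a m k⟩
  · rintro ⟨a, ha, rfl⟩
    exact ⟨a ^ m, ⟨a, ha, rfl⟩, (pow_mul a m k).symm⟩

/-- commutative group structure -/
abbrev Comm.commGroup {A : Subgroup H} (hA : Comm A) : CommGroup A :=
  { (inferInstance : Group A) with
    mul_comm := fun a b => Subtype.ext (hA a a.2 b b.2) }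

lemma card_transport {A : Subgroup H} (Y : Subgroup H) (hY : Y ≤ A)
    (S : Set (Additive A)) (h : ∀ a : A, Additive.ofMul a ∈ S ↔ (a : H) ∈ Y) :
    Nat.card S = Nat.card Y := by
  refine Nat.card_congr ⟨fun s => ⟨(Additive.toMul s.1 : A).1, (h _).1 s.2⟩,
    fun y => ⟨Additive.ofMul ⟨y.1, hY y.2⟩, (h _).2 y.2⟩, ?_, ?_⟩
  · intro s; rfl
  · intro y; rfl

lemma card_tors_mul_pow {A : Subgroup H} (hA : Comm A) (m : ℕ) :
    Nat.card A = Nat.card (torsS A hA m) * Nat.card (powS A hA m) := by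
  letI := hA.commGroup
  have h := card_eq_inf_ker_mul_map (⊤ : AddSubgroup (Additive A)) (mulE (Additive A) m)
  rw [top_inf_eq] at h
  have h1 : Nat.card (⊤ : AddSubgroup (Additive A)) = Nat.card A :=
    card_transport A le_rfl _ (by intro a; simp)
  have h2 : Nat.card (mulE (Additive A) m).ker = Nat.card (torsS A hA m) := by
    refine card_transport _ torsS_le _ ?_
    intro a
    rw [mem_torsS]
    constructor
    · intro h
      exact ⟨a.2, congrArg Subtype.val (show a ^ m = 1 from h)⟩
    · rintro ⟨-, h⟩
      change a ^ m = 1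
      exact Subtype.ext h
  have h3 : Nat.card ((⊤ : AddSubgroup (Additive A)).map (mulE (Additive A) m)) =
      Nat.card (powS A hA m) := by
    refine card_transport _ powS_le _ ?_
    intro a
    rw [mem_powS]
    constructor
    · rintro ⟨b, -, hb⟩
      exact ⟨_, (Additive.toMul b : A).2,
        congrArg Subtype.val (show (Additive.toMul b : A) ^ m = a from hb)⟩
    · rintro ⟨b, hb, hb'⟩
      exact ⟨Additive.ofMul ⟨b, hb⟩, trivial, Subtype.ext hb'⟩
  rw [← h1, h, h2, h3]

lemma card_torsS_pow_le [Finite H] {A : Subgroup H} (hA : Comm A) (p F : ℕ) :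
    Nat.card (torsS A hA (p ^ F)) ≤ Nat.card (torsS A hA p) ^ F := by
  letI := hA.commGroup
  have h2 : ∀ m, Nat.card (mulE (Additive A) m).ker = Nat.card (torsS A hA m) := by
    intro m
    refine card_transport _ torsS_le _ ?_
    intro a
    rw [mem_torsS]
    constructor
    · intro h
      exact ⟨a.2, congrArg Subtype.val (show a ^ m = 1 from h)⟩
    · rintro ⟨-, h⟩
      change a ^ m = 1
      exact Subtype.ext h
  rw [← h2, ← h2]
  haveI : Finite (Additive A) := inferInstanceAs (Finite A)
  exact card_tors_pow_le p F

lemma card_rank [Finite H] {A : Subgroup H} (hA : Comm A) (p F : ℕ) :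
    Nat.card A ≤ Nat.card (torsS A hA p) ^ F * Nat.card (powS A hA (p ^ F)) := by
  rw [card_tors_mul_pow hA (p ^ F)]
  exact Nat.mul_le_mul_right _ (card_torsS_pow_le hA p F)

/-- order of the conjugation action of `x` on `A` -/
noncomputable def ordc (A : Subgroup H) [A.Normal] (x : H) : ℕ :=
  orderOf (MulAut.conjNormal x : MulAut A)

lemma cen_mul_ord_le [Finite H] {A : Subgroup H} [A.Normal] (hA : Comm A) (x : H) :
    Nat.card (cen A x) * ordc A x ≤ Nat.card (Subgroup.centralizer {x} : Subgroup H) := by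
  have hinj : Function.Injective (fun q : cen A x × Fin (ordc A x) =>
      (⟨q.1.1 * x ^ (q.2 : ℕ), by
        have h1 : q.1.1 ∈ Subgroup.centralizer {x} := q.1.2.2
        refine Subgroup.mul_mem _ h1 (Subgroup.pow_mem _ ?_ _)
        simp [Subgroup.mem_centralizer_singleton_iff]⟩ :
        (Subgroup.centralizer {x} : Subgroup H))) := by
    rintro ⟨⟨c, hc⟩, k⟩ ⟨⟨c', hc'⟩, k'⟩ heq
    have h1 : c * x ^ (k : ℕ) = c' * x ^ (k' : ℕ) := congrArg Subtype.val heq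
    have triv : ∀ a ∈ A, (MulAut.conjNormal a : MulAut A) = 1 := by
      intro a ha
      ext b
      simp only [MulAut.conjNormal_apply, MulAut.one_apply]
      rw [hA a ha b b.2]; group
    have h2 := congrArg (fun g => (MulAut.conjNormal g : MulAut A)) h1
    simp only [map_mul, map_pow, triv c hc.1, triv c' hc'.1, one_mul] at h2
    have h3 : (k : ℕ) = k' := pow_injOn_Iio_orderOf k.2 k'.2 h2
    have h4 : k = k' := Fin.ext h3
    subst h4
    have h5 : c = c' := by simpa using h1
    subst h5
    rfl
  have := Nat.card_le_card_of_injective _ hinj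
  rwa [Nat.card_prod, Nat.card_eq_fintype_card (α := Fin _), Fintype.card_fin] at this

lemma ordc_pow {p n : ℕ} (hp : p.Prime) (hH : Nat.card H = p ^ n) {A : Subgroup H} [A.Normal]
    (x : H) : ∃ f, ordc A x = p ^ f := by
  have h1 : ordc A x ∣ p ^ n := by
    rw [← hH]
    exact (orderOf_map_dvd (MulAut.conjNormal : H →* MulAut A) x).trans (orderOf_dvd_natCard x)
  obtain ⟨f, -, hf⟩ := (Nat.dvd_prime_pow hp).1 h1
  exact ⟨f, hf⟩

section
variable {A : Subgroup H} [A.Normal]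

/-- conjugation as an endomorphism -/
def conjE (A : Subgroup H) [A.Normal] (hA : Comm A) (x : H) :
    letI := hA.commGroup; AddMonoid.End (Additive A) :=
  letI := hA.commGroup
  MonoidHom.toAdditive (MulAut.conjNormal x : MulAut A).toMonoidHom

lemma conjE_pow (hA : Comm A) (x : H) (k : ℕ) (a : A) :
    letI := hA.commGroup
    ((conjE A hA x) ^ k : AddMonoid.End (Additive A)) (Additive.ofMul a) =
      Additive.ofMul (((MulAut.conjNormal x : MulAut A) ^ k) a) := by
  letI := hA.commGroup
  induction k generalizing a with
  | zero => rfl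
  | succ k ih =>
    rw [pow_succ, pow_succ]
    exact ih _

lemma conjE_pow_eq_one (hA : Comm A) (x : H) (k : ℕ) (hk : ordc A x ∣ k) :
    letI := hA.commGroup
    (conjE A hA x) ^ k = (1 : AddMonoid.End (Additive A)) := by
  letI := hA.commGroup
  refine AddMonoidHom.ext fun a => ?_
  have h : (MulAut.conjNormal x : MulAut A) ^ k = 1 := orderOf_dvd_iff_pow_eq_one.1 hk
  have := conjE_pow hA x k (Additive.toMul a)
  rw [h] at this
  exact this

lemma conjE_ker (hA : Comm A) (x : H) (a : A) :
    letI := hA.commGroup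
    Additive.ofMul a ∈ fixE (conjE A hA x) ↔
      (a : H) ∈ cen A x := by
  letI := hA.commGroup
  rw [mem_cen]
  change (MulAut.conjNormal x : MulAut A) a = a ↔ _
  rw [Subtype.ext_iff, MulAut.conjNormal_apply]
  constructor
  · intro h
    exact ⟨a.2, mul_inv_eq_iff_eq_mul.1 h⟩
  · rintro ⟨-, h⟩
    exact mul_inv_eq_iff_eq_mul.2 h

lemma tors_le_cen_pow [Finite H] {p n : ℕ} (hp : p.Prime) (hH : Nat.card H = p ^ n)
    (hA : Comm A) (x : H) :
    Nat.card (torsS A hA p) ≤ Nat.card (cen A x) ^ ordc A x := by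
  letI := hA.commGroup
  haveI : Finite (Additive A) := inferInstanceAs (Finite A)
  obtain ⟨f, hf⟩ := ordc_pow (A := A) hp hH x
  have h := tors_le_fix_pow hp f (conjE A hA x) (conjE_pow_eq_one hA x _ hf.dvd)
  rw [← hf] at h
  have h1 : Nat.card (fixE (conjE A hA x)) =
      Nat.card (cen A x) :=
    card_transport (cen A x) inf_le_left _ (conjE_ker hA x)
  have h2 : Nat.card (mulE (Additive A) p).ker = Nat.card (torsS A hA p) := by
    refine card_transport _ torsS_le _ ?_
    intro a
    rw [mem_torsS]
    constructor
    · intro h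
      exact ⟨a.2, congrArg Subtype.val (show a ^ p = 1 from h)⟩
    · rintro ⟨-, h⟩
      change a ^ p = 1
      exact Subtype.ext h
  rwa [h1, h2] at h

lemma trace_group [Finite H] {p n : ℕ} (hp : p.Prime) (hH : Nat.card H = p ^ n)
    (hA : Comm A) (x : H) (e : ℕ) (Y Z : Subgroup H) (hY : Y = powS A hA (p ^ (2 * e)))
    (hZ : Z = torsS Y (hA.mono (hY ▸ powS_le)) (p ^ e)) :
    p ^ e * Nat.card (cen Y x) ≤
      Nat.card (Subgroup.centralizer {x} : Subgroup H) + p ^ e * Nat.card (cen Z x) := by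
  by_cases hsub : cen Y x ≤ Z
  · have : cen Y x ≤ cen Z x := fun y hy => ⟨hsub hy, hy.2⟩
    have h := Nat.card_mono (Set.toFinite _) this
    exact le_trans (Nat.mul_le_mul_left _ h) (Nat.le_add_left _ _)
  refine le_trans ?_ (Nat.le_add_right _ _)
  have hYA : Y ≤ A := hY ▸ powS_le
  have hYA' : cen Y x ≤ cen A x := fun y hy => ⟨hYA hy.1, hy.2⟩
  obtain ⟨f, hf⟩ := ordc_pow (A := A) hp hH x
  by_cases hef : e ≤ f
  · refine le_trans ?_ (cen_mul_ord_le hA x)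
    rw [mul_comm]
    apply Nat.mul_le_mul (Nat.card_mono (Set.toFinite _) hYA')
    rw [hf]
    exact Nat.pow_le_pow_right hp.pos hef
  have hef' : f ≤ e := by omega
  have hcen : Nat.card (cen A x) ≤ Nat.card (Subgroup.centralizer {x} : Subgroup H) :=
    Nat.card_mono (Set.toFinite _) (fun y hy => hy.2)
  refine le_trans ?_ hcen
  letI := hA.commGroup
  haveI : Finite (Additive A) := inferInstanceAs (Finite A)
  rw [SetLike.not_le_iff_exists] at hsub
  obtain ⟨y, hy, hyZ⟩ := hsub
  obtain ⟨k, -, hk⟩ : ∃ k ≤ n, Nat.card A = p ^ k :=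
    (Nat.dvd_prime_pow hp).1 (hH ▸ Subgroup.card_subgroup_dvd_card A)
  have hr : ∀ a : A, Additive.ofMul a ∈ (mulE (Additive A) (p ^ (2 * e))).range ↔ (a : H) ∈ Y := by
    intro a
    rw [hY, mem_powS]
    constructor
    · rintro ⟨b, hb⟩
      exact ⟨_, (Additive.toMul b : A).2,
        congrArg Subtype.val (show (Additive.toMul b : A) ^ _ = a from hb)⟩
    · rintro ⟨b, hb, hb'⟩
      exact ⟨Additive.ofMul ⟨b, hb⟩, Subtype.ext hb'⟩
  have h := trace_lemma (V := Additive A) hp e k hk (conjE A hA x)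
    (conjE_pow_eq_one hA x _ (hf ▸ pow_dvd_pow _ hef')) (Additive.ofMul ⟨y, hYA hy.1⟩)
    ((conjE_ker hA x _).2 (hYA' hy)) ((hr _).2 hy.1) (by
      intro h0
      apply hyZ
      rw [hZ, mem_torsS]
      exact ⟨hy.1, congrArg Subtype.val (show (⟨y, hYA hy.1⟩ : A) ^ p ^ e = 1 from h0)⟩)
  have h1 : Nat.card (fixE (conjE A hA x)) =
      Nat.card (cen A x) :=
    card_transport (cen A x) inf_le_left _ (conjE_ker hA x)
  have h2 : Nat.card (fixE (conjE A hA x) ⊓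
      (mulE (Additive A) (p ^ (2 * e))).range : AddSubgroup (Additive A)) =
      Nat.card (cen Y x) := by
    refine card_transport (cen Y x) (inf_le_left.trans hYA) _ ?_
    intro a
    constructor
    · rintro ⟨h3, h4⟩
      exact ⟨(hr a).1 h4, ((conjE_ker hA x a).1 h3).2⟩
    · intro h3
      exact ⟨(conjE_ker hA x a).2 (hYA' h3), (hr a).2 h3.1⟩
  rwa [h1, h2] at h
end

end Abelian

section Classes
open scoped commutatorElement
variable {H : Type} [Group H]

/-- number of conjugacy classes of `H` meeting `Y` -/
noncomputable def kap (Y : Subgroup H) : ℕ := (ConjClasses.mk '' (Y : Set H)).ncard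

lemma kap_top : kap (⊤ : Subgroup H) = Nat.card (ConjClasses H) := by
  unfold kap
  rw [Subgroup.coe_top, Set.image_univ, (ConjClasses.mk_surjective).range_eq, Set.ncard_univ]

lemma burnside [Fintype H] (Y : Subgroup H) [hY : Y.Normal] :
    ∑ x : H, Nat.card (cen Y x) = kap Y * Nat.card H := by
  classical
  letI : MulAction H Y := MulAction.compHom Y (MulAut.conjNormal : H →* MulAut Y)
  have hs : ∀ (x : H) (y : Y), ((x • y : Y) : H) = x * y * x⁻¹ := fun x y => rfl
  letI : Fintype (Quotient (MulAction.orbitRel H Y)) := Fintype.ofFinite _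
  letI : ∀ x : H, Fintype (MulAction.fixedBy Y x) := fun x => Fintype.ofFinite _
  have hb := MulAction.sum_card_fixedBy_eq_card_orbits_mul_card_group H Y
  rw [← Nat.card_eq_fintype_card (α := H), ← Nat.card_eq_fintype_card] at hb
  have h1 : ∀ x : H, Fintype.card (MulAction.fixedBy Y x) = Nat.card (cen Y x) := by
    intro x
    rw [← Nat.card_eq_fintype_card]
    refine Nat.card_congr ⟨fun y => ⟨y.1.1, mem_cen.2 ⟨y.1.2, ?_⟩⟩,
      fun y => ⟨⟨y.1, (mem_cen.1 y.2).1⟩, ?_⟩, fun _ => rfl, fun _ => rfl⟩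
    · have h2 : x • y.1 = y.1 := y.2
      have h3 := congrArg Subtype.val h2
      rw [hs] at h3
      exact mul_inv_eq_iff_eq_mul.1 h3
    · change x • _ = _
      apply Subtype.ext
      rw [hs]
      exact mul_inv_eq_iff_eq_mul.2 (mem_cen.1 y.2).2
  have h2 : Nat.card (Quotient (MulAction.orbitRel H Y)) = kap Y := by
    unfold kap
    rw [← Nat.card_coe_set_eq]
    refine Nat.card_eq_of_bijective (fun q => Quotient.liftOn' q
      (fun y => (⟨ConjClasses.mk y.1, y.1, y.2, rfl⟩ : ConjClasses.mk '' (Y : Set H))) ?_) ⟨?_, ?_⟩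
    · rintro a b ⟨x, hx⟩
      apply Subtype.ext
      apply ConjClasses.mk_eq_mk_iff_isConj.2
      rw [isConj_comm, isConj_iff]
      refine ⟨x, ?_⟩
      rw [← hs]
      exact congrArg Subtype.val hx
    · intro a b
      refine Quotient.inductionOn₂' a b ?_
      intro a b hab
      have h3 : ConjClasses.mk a.1 = ConjClasses.mk b.1 := congrArg Subtype.val hab
      rw [ConjClasses.mk_eq_mk_iff_isConj, isConj_comm, isConj_iff] at h3
      obtain ⟨x, hx⟩ := h3
      apply Quotient.sound'
      refine ⟨x, Subtype.ext ?_⟩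
      exact hx
    · rintro ⟨_, y, hy, rfl⟩
      exact ⟨Quotient.mk'' ⟨y, hy⟩, rfl⟩
  rw [← h2, ← hb]
  exact Finset.sum_congr rfl fun x _ => (h1 x).symm

lemma burnside_top [Fintype H] :
    ∑ x : H, Nat.card (Subgroup.centralizer {x} : Subgroup H) =
      Nat.card (ConjClasses H) * Nat.card H := by
  rw [← kap_top, ← burnside]
  simp [cen]

lemma card_map_mk [Finite H] (Y Y' : Subgroup H) [Y'.Normal] (hle : Y' ≤ Y) :
    Nat.card Y' * Nat.card (Y.map (QuotientGroup.mk' Y')) = Nat.card Y := by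
  have h1 := Subgroup.relIndex_ker Y (QuotientGroup.mk' Y')
  rw [QuotientGroup.ker_mk'] at h1
  rw [← h1]
  have h2 := Subgroup.relIndex_mul_relIndex (⊥ : Subgroup H) Y' Y bot_le hle
  rwa [Subgroup.relIndex_bot_left, Subgroup.relIndex_bot_left] at h2

lemma kap_mono [Finite H] {Y' Y : Subgroup H} (h : Y' ≤ Y) : kap Y' ≤ kap Y :=
  Set.ncard_le_ncard (Set.image_mono h) (Set.toFinite _)

lemma kap_step [Finite H] (Y Y' : Subgroup H) [Y.Normal] [hn : Y'.Normal] (hle : Y' ≤ Y)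
    (hc : ⁅Y, (⊤ : Subgroup H)⁆ ≤ Y') (q : ℕ) (hq : Nat.card Y = q * Nat.card Y') :
    kap Y' + q ≤ kap Y + 1 := by
  set π := QuotientGroup.mk' Y' with hπ
  have hq' : Nat.card (Y.map π) = q := by
    have := card_map_mk Y Y' hle
    rw [hq, mul_comm q] at this
    exact Nat.eq_of_mul_eq_mul_left Nat.card_pos this
  have hconst : ∀ y ∈ Y, ∀ z, IsConj y z → π y = π z := by
    intro y hy z hz
    obtain ⟨g, rfl⟩ := isConj_iff.1 hz
    have h1 : ⁅y, g⁆ ∈ Y' := hc (Subgroup.commutator_mem_commutator hy (Subgroup.mem_top g))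
    symm
    apply QuotientGroup.eq.2
    have : (g * y * g⁻¹)⁻¹ * y = g * y⁻¹ * g⁻¹ * y := by group
    rw [this]
    have h2 := hn.conj_mem _ h1 y⁻¹
    convert h2 using 1
    rw [commutatorElement_def]; group
  set S := ConjClasses.mk '' (Y : Set H) with hS
  set S' := ConjClasses.mk '' (Y' : Set H) with hS'
  have hSS : S' ⊆ S := Set.image_mono hle
  have h1 : (S \ S').ncard + S'.ncard = S.ncard :=
    Set.ncard_sdiff_add_ncard_of_subset hSS (Set.toFinite _)
  have h2 : (((Y.map π : Subgroup (H ⧸ Y')) : Set (H ⧸ Y')) \ {1}).ncard + 1 = q := by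
    have := Set.ncard_sdiff_singleton_add_one (s := ((Y.map π : Subgroup (H ⧸ Y')) : Set (H ⧸ Y')))
      (Y.map π).one_mem (Set.toFinite _)
    rw [this, ← Nat.card_coe_set_eq]
    exact hq'
  have h3 : (((Y.map π : Subgroup (H ⧸ Y')) : Set (H ⧸ Y')) \ {1}) ⊆
      (fun c : ConjClasses H => π (Quotient.out c)) '' (S \ S') := by
    rintro _ ⟨⟨y, hy, rfl⟩, hy1⟩
    have hout : IsConj y (Quotient.out (ConjClasses.mk y)) := by
      rw [← ConjClasses.mk_eq_mk_iff_isConj]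
      exact (Quotient.out_eq (ConjClasses.mk y)).symm
    refine ⟨ConjClasses.mk y, ⟨⟨y, hy, rfl⟩, ?_⟩, (hconst y hy _ hout).symm⟩
    rintro ⟨z, hz, hzy⟩
    apply hy1
    rw [ConjClasses.mk_eq_mk_iff_isConj] at hzy
    have : π z = π y := hconst z (hle hz) y hzy
    rw [Set.mem_singleton_iff, ← this]
    exact (QuotientGroup.eq_one_iff z).2 hz
  have h4 := (Set.ncard_le_ncard h3 (Set.toFinite _)).trans (Set.ncard_image_le (Set.toFinite _))
  change S'.ncard + q ≤ S.ncard + 1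
  omega

/-- pointwise version of step for `p`-powers -/
lemma kap_step_pow [Finite H] {p : ℕ} (hp : p.Prime) (Y Y' : Subgroup H) [Y.Normal] [Y'.Normal]
    (hle : Y' ≤ Y) (hc : ⁅Y, (⊤ : Subgroup H)⁆ ≤ Y') (b b' : ℕ) (hb : Nat.card Y = p ^ b)
    (hb' : Nat.card Y' = p ^ b') : b' ≤ b ∧ kap Y' + p ^ (b - b') ≤ kap Y + 1 := by
  have h1 : b' ≤ b := by
    have h := Nat.card_mono (Set.toFinite _) hle
    change Nat.card Y' ≤ Nat.card Y at h
    rw [hb, hb'] at h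
    exact (Nat.pow_le_pow_iff_right hp.one_lt).1 h
  refine ⟨h1, kap_step Y Y' hle hc _ ?_⟩
  rw [hb, hb', ← pow_add]
  congr 1; omega

lemma three_sub (A B C N : Subgroup H) [N.Normal] (h1 : ⁅⁅B, C⁆, A⁆ ≤ N) (h2 : ⁅⁅C, A⁆, B⁆ ≤ N) :
    ⁅⁅A, B⁆, C⁆ ≤ N := by
  have key : ∀ X : Subgroup H, X ≤ N ↔ X.map (QuotientGroup.mk' N) = ⊥ := by
    intro X
    rw [Subgroup.map_eq_bot_iff, QuotientGroup.ker_mk']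
  rw [key, Subgroup.map_commutator, Subgroup.map_commutator] at *
  exact Subgroup.commutator_commutator_eq_bot_of_rotate h1 h2

lemma sup_comm_le (X Z N : Subgroup H) [N.Normal] (h1 : ⁅X, (⊤ : Subgroup H)⁆ ≤ N)
    (h2 : ⁅Z, (⊤ : Subgroup H)⁆ ≤ N) : ⁅X ⊔ Z, (⊤ : Subgroup H)⁆ ≤ N := by
  have key : ∀ X : Subgroup H, ⁅X, (⊤ : Subgroup H)⁆ ≤ N ↔
      X.map (QuotientGroup.mk' N) ≤ Subgroup.center (H ⧸ N) := by
    intro X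
    have hs : (⊤ : Subgroup H).map (QuotientGroup.mk' N) = ⊤ :=
      Subgroup.map_top_of_surjective _ (QuotientGroup.mk'_surjective N)
    rw [← Subgroup.commutator_top_right_eq_bot_iff_le_center, ← hs, ← Subgroup.map_commutator,
      Subgroup.map_eq_bot_iff, QuotientGroup.ker_mk']
  rw [key] at *
  rw [Subgroup.map_sup]
  exact sup_le h1 h2

/-- lower central series -/
abbrev lcs (H : Type) [Group H] (t : ℕ) : Subgroup H := (⊤ : Subgroup H).lowerCentralSeries t

lemma lcs_comm (s t : ℕ) : ⁅lcs H t, lcs H s⁆ ≤ lcs H (s + t + 1) := by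
  induction t generalizing s with
  | zero =>
    rw [Subgroup.commutator_comm]
    exact le_rfl
  | succ t ih =>
    apply three_sub (lcs H t) ⊤ (lcs H s) (lcs H (s + (t + 1) + 1))
    · rw [Subgroup.commutator_comm ⊤, Subgroup.commutator_comm]
      have := ih (s + 1)
      refine le_trans this (le_of_eq ?_)
      congr 1; omega
    · rw [Subgroup.commutator_comm (lcs H s)]
      exact Subgroup.commutator_mono (ih s) le_rfl

lemma card_pow_sub {p n : ℕ} (hp : p.Prime) (hH : Nat.card H = p ^ n) (Y : Subgroup H) :
    ∃ b, Nat.card Y = p ^ b := by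
  obtain ⟨b, -, hb⟩ := (Nat.dvd_prime_pow hp).1 (hH ▸ Subgroup.card_subgroup_dvd_card Y)
  exact ⟨b, hb⟩

lemma nilp [Finite H] {p n : ℕ} (hp : p.Prime) (hH : Nat.card H = p ^ n) :
    ∃ t, lcs H t = ⊥ := by
  haveI : Fact p.Prime := ⟨hp⟩
  have h : IsPGroup p H := IsPGroup.of_card hH
  exact Subgroup.nilpotent_iff_lowerCentralSeries.1 h.isNilpotent

lemma comm_lt [Finite H] {p n : ℕ} (hp : p.Prime) (hH : Nat.card H = p ^ n)
    (Y Z : Subgroup H) [Y.Normal] [hZ : Z.Normal] (h : Z ≤ Y)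
    (hY : Y ≤ ⁅Y, (⊤ : Subgroup H)⁆ ⊔ Z) : Y = Z := by
  have key : ∀ t, Y ≤ lcs H t ⊔ Z := by
    intro t
    induction t with
    | zero => exact le_trans le_top le_sup_left
    | succ t ih =>
      refine hY.trans (sup_le ?_ le_sup_right)
      refine le_trans (Subgroup.commutator_mono ih le_rfl) ?_
      apply sup_comm_le
      · exact le_sup_left
      · exact le_trans (Subgroup.commutator_le_left Z ⊤) le_sup_right
  obtain ⟨t, ht⟩ := nilp hp hH
  have := key t
  rw [ht, bot_sup_eq] at this
  exact le_antisymm this h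

lemma kap_log [Finite H] {p n : ℕ} (hp : p.Prime) (hH : Nat.card H = p ^ n) (b : ℕ) :
    ∀ (Y Z : Subgroup H) [Y.Normal] [Z.Normal], Z ≤ Y → ∀ b', Nat.card Y = p ^ b →
      Nat.card Z = p ^ b' → b + kap Z ≤ b' + kap Y := by
  induction b using Nat.strong_induction_on with
  | _ b ih =>
    intro Y Z _ _ hZY b' hb hb'
    by_cases hYZ : Y ≤ ⁅Y, (⊤ : Subgroup H)⁆ ⊔ Z
    · have := comm_lt hp hH Y Z hZY hYZ
      subst this
      have : b = b' := Nat.pow_right_injective hp.two_le (hb.symm.trans hb')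
      omega
    · set Y' := ⁅Y, (⊤ : Subgroup H)⁆ ⊔ Z with hY'
      have hle : Y' ≤ Y := sup_le (Subgroup.commutator_le_left Y ⊤) hZY
      obtain ⟨d, hd⟩ := card_pow_sub hp hH Y'
      obtain ⟨h1, h2⟩ := kap_step_pow hp Y Y' hle le_sup_left b d hb hd
      have hlt : d < b := by
        rcases h1.lt_or_eq with h | h
        · exact h
        · exfalso
          apply hYZ
          subst h
          have : (Y' : Set H) = Y := Set.eq_of_subset_of_ncard_le hle (by
            rw [← Nat.card_coe_set_eq, ← Nat.card_coe_set_eq]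
            exact (hb.trans hd.symm).le) (Set.toFinite _)
          exact this.ge
      have h3 := ih d hlt Y' Z le_sup_right b' hd hb'
      have h4 : b - d < p ^ (b - d) := Nat.lt_pow_self hp.one_lt
      omega

lemma kap_bot : kap (⊥ : Subgroup H) = 1 := by
  unfold kap
  simp

lemma k_ge [Finite H] {p n : ℕ} (hp : p.Prime) (hH : Nat.card H = p ^ n) :
    n + 1 ≤ Nat.card (ConjClasses H) := by
  have := kap_log hp hH n ⊤ ⊥ bot_le 0 (by simpa using hH) (by simp)
  rw [kap_bot, kap_top] at this
  omega

lemma k_quot [Finite H] (N : Subgroup H) [N.Normal] :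
    Nat.card (ConjClasses (H ⧸ N)) ≤ Nat.card (ConjClasses H) :=
  Nat.card_le_card_of_surjective _
    (ConjClasses.map_surjective (f := QuotientGroup.mk' N) (QuotientGroup.mk'_surjective N))

end Classes

section Scales

lemma quad_le (δ : ℕ) : (3 + δ) * (2 + δ) ≤ 14 * 2 ^ δ := by
  induction δ with
  | zero => norm_num
  | succ δ ih =>
    rw [pow_succ]
    nlinarith

lemma term_nat {p : ℕ} (hp : 2 ≤ p) (u u' b : ℕ) (hb : 1 ≤ b) (h1 : u' ≤ u) (h2 : u' ≤ b) :
    p ^ u' * ((2 * b + u) * (b + u)) ≤ 14 * p ^ u * b ^ 2 := by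
  rcases le_total u b with h | h
  · have : p ^ u' ≤ p ^ u := Nat.pow_le_pow_right (by omega) h1
    have h3 : (2 * b + u) * (b + u) ≤ 14 * b ^ 2 := by nlinarith
    calc _ ≤ p ^ u * (14 * b ^ 2) := Nat.mul_le_mul this h3
      _ = _ := by ring
  · obtain ⟨δ, rfl⟩ := Nat.exists_eq_add_of_le h
    have h3 : p ^ u' ≤ p ^ b := Nat.pow_le_pow_right (by omega) h2
    have h4 : 2 ^ δ ≤ p ^ δ := Nat.pow_le_pow_left hp δ
    have h5 := quad_le δ
    have h6 : δ ≤ b * δ := by nlinarith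
    have h7 : (2 * b + (b + δ)) * (b + (b + δ)) ≤ b ^ 2 * ((3 + δ) * (2 + δ)) := by
      have : (2 * b + (b + δ)) ≤ b * (3 + δ) := by nlinarith
      have h8 : (b + (b + δ)) ≤ b * (2 + δ) := by nlinarith
      calc _ ≤ (b * (3 + δ)) * (b * (2 + δ)) := Nat.mul_le_mul this h8
        _ = _ := by ring
    calc _ ≤ p ^ b * (b ^ 2 * ((3 + δ) * (2 + δ))) := Nat.mul_le_mul h3 h7
      _ ≤ p ^ b * (b ^ 2 * (14 * p ^ δ)) := 
        Nat.mul_le_mul_left _ (Nat.mul_le_mul_left _ (h5.trans (Nat.mul_le_mul_left _ h4)))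
      _ = _ := by rw [pow_add]; ring

lemma scale_sum {p : ℕ} (hp : 2 ≤ p) (u : ℕ) (hu : 1 ≤ u) (u' b : ℕ → ℕ) (m : ℕ)
    (hb : ∀ k < m, 1 ≤ b k) (h1 : ∀ k < m, u' k ≤ u) (h2 : ∀ k < m, u' k ≤ b k)
    (hg : ∀ k, k + 1 < m → 2 * b k ≤ b (k + 1)) :
    (u : ℝ) * ∑ k ∈ Finset.range m, (p : ℝ) ^ u' k / b k ≤ 14 * (p : ℝ) ^ u := by
  have hu' : (0 : ℝ) < u := by exact_mod_cast hu
  set ψ : ℝ → ℝ := fun z => z / (z + u) with hψ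
  have hψ0 : ∀ z, 0 ≤ z → 0 ≤ ψ z := fun z hz => by positivity
  have hψ1 : ∀ z, 0 ≤ z → ψ z ≤ 1 := fun z hz => by
    rw [hψ]
    exact div_le_one_of_le₀ (by linarith) (by linarith)
  have hψm : ∀ z w, 0 ≤ z → z ≤ w → ψ z ≤ ψ w := fun z w hz hzw => by
    simp only [hψ]
    rw [div_le_div_iff₀ (by linarith) (by linarith)]
    nlinarith
  have hterm : ∀ k < m, (u : ℝ) * ((p : ℝ) ^ u' k / b k) ≤
      14 * (p : ℝ) ^ u * (ψ (2 * b k) - ψ (b k)) := by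
    intro k hk
    have hbk : (0 : ℝ) < b k := by exact_mod_cast hb k hk
    have h3 := term_nat hp u (u' k) (b k) (hb k hk) (h1 k hk) (h2 k hk)
    have h3' : (p : ℝ) ^ u' k * ((2 * b k + u) * (b k + u)) ≤ 14 * (p : ℝ) ^ u * (b k : ℝ) ^ 2 := by
      exact_mod_cast h3
    have h4 : ψ (2 * b k) - ψ (b k) = (b k * u) / ((2 * b k + u) * (b k + u)) := by
      simp only [hψ]
      field_simp
      ring
    rw [h4, ← mul_div_assoc, ← mul_div_assoc, div_le_div_iff₀ hbk (by positivity)]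
    calc (u : ℝ) * (p : ℝ) ^ u' k * ((2 * b k + u) * (b k + u))
        = u * ((p : ℝ) ^ u' k * ((2 * b k + u) * (b k + u))) := by ring
      _ ≤ u * (14 * (p : ℝ) ^ u * (b k : ℝ) ^ 2) := by gcongr
      _ = _ := by ring
  have htel : ∀ j, j < m → ∑ k ∈ Finset.range (j + 1), (ψ (2 * b k) - ψ (b k)) ≤ ψ (2 * b j) := by
    intro j
    induction j with
    | zero =>
      intro _
      simp only [zero_add, Finset.sum_range_one]
      have := hψ0 (b 0) (by positivity)
      linarith
    | succ j ih =>
      intro hj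
      rw [Finset.sum_range_succ]
      have h5 := ih (by omega)
      have h6 := hψm (2 * b j) (b (j + 1)) (by positivity) (by exact_mod_cast hg j hj)
      linarith
  have hsum : ∑ k ∈ Finset.range m, (ψ (2 * b k) - ψ (b k)) ≤ 1 := by
    cases m with
    | zero => simp
    | succ j => exact (htel j (by omega)).trans (hψ1 _ (by positivity))
  rw [Finset.mul_sum]
  calc ∑ k ∈ Finset.range m, (u : ℝ) * ((p : ℝ) ^ u' k / b k)
      ≤ ∑ k ∈ Finset.range m, 14 * (p : ℝ) ^ u * (ψ (2 * b k) - ψ (b k)) :=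
        Finset.sum_le_sum fun k hk => hterm k (Finset.mem_range.1 hk)
    _ = 14 * (p : ℝ) ^ u * ∑ k ∈ Finset.range m, (ψ (2 * b k) - ψ (b k)) := by
        rw [Finset.mul_sum]
    _ ≤ 14 * (p : ℝ) ^ u * 1 := by gcongr
    _ = _ := mul_one _

variable {H : Type} [Group H] [Finite H]

lemma lemS {p n : ℕ} (hp : p.Prime) (hH : Nat.card H = p ^ n) {A : Subgroup H} [A.Normal]
    (hA : Comm A) (r : ℕ) (hr : Nat.card (torsS A hA p) = p ^ r)
    (Y : ℕ → Subgroup H) (b : ℕ → ℕ) (m : ℕ) (hYn : ∀ k < m, (Y k).Normal)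
    (hYA : ∀ k < m, Y k ≤ A) (hYc : ∀ k < m, Nat.card (Y k) = p ^ b k) (hb : ∀ k < m, 1 ≤ b k)
    (hg : ∀ k, k + 1 < m → 2 * b k ≤ b (k + 1)) :
    (r : ℝ) * ∑ k ∈ Finset.range m, (kap (Y k) : ℝ) / b k ≤ 14 * Nat.card (ConjClasses H) := by
  classical
  letI : Fintype H := Fintype.ofFinite H
  have hpt : ∀ x : H, (r : ℝ) * ∑ k ∈ Finset.range m, (Nat.card (cen (Y k) x) : ℝ) / b k ≤
      14 * Nat.card (Subgroup.centralizer {x} : Subgroup H) := by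
    intro x
    obtain ⟨u, hu⟩ := card_pow_sub hp hH (cen A x)
    choose u' hu' using fun k => card_pow_sub hp hH (cen (Y k) x)
    have h1 := tors_le_cen_pow hp hH hA x
    have h2 := cen_mul_ord_le hA x
    rw [hr, hu, ← pow_mul, Nat.pow_le_pow_iff_right hp.one_lt] at h1
    rw [hu] at h2
    rcases Nat.eq_zero_or_pos u with h0 | h0
    · have : r = 0 := by
        rw [h0, zero_mul] at h1; omega
      rw [this]
      simp only [Nat.cast_zero, zero_mul]
      positivity
    have h3 := scale_sum hp.two_le u h0 u' b m hb (by
      intro k hk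
      rw [← Nat.pow_le_pow_iff_right hp.one_lt, ← hu, ← hu']
      exact Nat.card_mono (Set.toFinite _) (inf_le_inf_right _ (hYA k hk))) (by
      intro k hk
      rw [← Nat.pow_le_pow_iff_right hp.one_lt, ← hu', ← hYc k hk]
      exact Nat.card_mono (Set.toFinite _) inf_le_left) hg
    simp only [hu', Nat.cast_pow]
    have hsn : (0 : ℝ) ≤ ∑ k ∈ Finset.range m, (p : ℝ) ^ u' k / b k :=
      Finset.sum_nonneg fun k _ => by positivity
    have h1' : (r : ℝ) ≤ u * ordc A x := by exact_mod_cast h1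
    have h2' : (p : ℝ) ^ u * ordc A x ≤ Nat.card (Subgroup.centralizer {x} : Subgroup H) := by
      exact_mod_cast h2
    calc (r : ℝ) * ∑ k ∈ Finset.range m, (p : ℝ) ^ u' k / b k
        ≤ (u * ordc A x) * ∑ k ∈ Finset.range m, (p : ℝ) ^ u' k / b k := by gcongr
      _ = (u * ∑ k ∈ Finset.range m, (p : ℝ) ^ u' k / b k) * ordc A x := by ring
      _ ≤ (14 * (p : ℝ) ^ u) * ordc A x := by gcongr
      _ = 14 * ((p : ℝ) ^ u * ordc A x) := by ring
      _ ≤ _ := by gcongr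
  have hs := Finset.sum_le_sum fun (x : H) (_ : x ∈ Finset.univ) => hpt x
  rw [← Finset.mul_sum, ← Finset.mul_sum, Finset.sum_comm] at hs
  have h5 : (∑ x : H, (Nat.card (Subgroup.centralizer {x} : Subgroup H) : ℝ)) =
      Nat.card (ConjClasses H) * Nat.card H := by exact_mod_cast burnside_top (H := H)
  have h6 : ∀ k ∈ Finset.range m, ∑ x : H, (Nat.card (cen (Y k) x) : ℝ) / b k =
      (kap (Y k) : ℝ) / b k * Nat.card H := by
    intro k hk
    haveI := hYn k (Finset.mem_range.1 hk)
    rw [← Finset.sum_div]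
    have : (∑ x : H, (Nat.card (cen (Y k) x) : ℝ)) = kap (Y k) * Nat.card H := by
      exact_mod_cast burnside (Y k)
    rw [this]; ring
  rw [h5, Finset.sum_congr rfl h6, ← Finset.sum_mul, ← mul_assoc, ← mul_assoc] at hs
  exact le_of_mul_le_mul_right hs (by exact_mod_cast Nat.card_pos)

lemma lemT {p n : ℕ} (hp : p.Prime) (hH : Nat.card H = p ^ n) {A : Subgroup H} [A.Normal]
    (hA : Comm A) (e s : ℕ) (hs : Nat.card (powS A hA (p ^ (3 * e))) = p ^ s) :
    p ^ e * s ≤ Nat.card (ConjClasses H) := by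
  classical
  letI : Fintype H := Fintype.ofFinite H
  set Y := powS A hA (p ^ (2 * e)) with hY
  have hYA : Comm Y := hA.mono powS_le
  set Z := torsS Y hYA (p ^ e) with hZ
  haveI : Y.Normal := powS_normal
  haveI : Z.Normal := torsS_normal
  have h1 := Finset.sum_le_sum fun (x : H) (_ : x ∈ Finset.univ) =>
    trace_group hp hH hA x e Y Z hY hZ
  rw [← Finset.mul_sum, Finset.sum_add_distrib, ← Finset.mul_sum, burnside, burnside,
    burnside_top, ← mul_assoc, ← mul_assoc, ← add_mul] at h1
  have h2 := Nat.le_of_mul_le_mul_right h1 Nat.card_pos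
  obtain ⟨bY, hbY⟩ := card_pow_sub hp hH Y
  obtain ⟨bZ, hbZ⟩ := card_pow_sub hp hH Z
  have h3 := kap_log hp hH bY Y Z torsS_le bZ hbY hbZ
  have h4 := card_tors_mul_pow hYA (p ^ e)
  rw [powS_powS, ← pow_add, show 2 * e + e = 3 * e by ring, hs, ← hZ, hbY, hbZ, ← pow_add] at h4
  have h5 := Nat.pow_right_injective hp.two_le h4
  have h6 : s + kap Z ≤ kap Y := by omega
  have h7 := Nat.mul_le_mul_left (p ^ e) h6
  rw [mul_add] at h7
  omega

end Scales

section Core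
variable {H : Type} [Group H] [Finite H]

lemma sq_le_pow2 (w : ℕ) : w ^ 2 + 2 ≤ 2 * 2 ^ w := by
  induction w with
  | zero => norm_num
  | succ w ih =>
    rcases Nat.lt_or_ge w 2 with h | h
    · interval_cases w <;> norm_num
    · have h2 : 2 * 2 ^ (w + 1) = 2 * (2 * 2 ^ w) := by ring
      nlinarith

lemma lcs_step {p : ℕ} (hp : p.Prime) (b : ℕ → ℕ)
    (hb : ∀ t, Nat.card (lcs H t) = p ^ b t) (t : ℕ) :
    b (t + 1) ≤ b t ∧ kap (lcs H (t + 1)) + p ^ (b t - b (t + 1)) ≤ kap (lcs H t) + 1 :=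
  kap_step_pow hp (lcs H t) (lcs H (t + 1))
    (Subgroup.lowerCentralSeries_antitone _ (Nat.le_succ t)) le_rfl _ _ (hb t) (hb (t + 1))

lemma kap_lcs {p : ℕ} (hp : p.Prime) (b : ℕ → ℕ)
    (hb : ∀ t, Nat.card (lcs H t) = p ^ b t) (E : ℕ) (hE : b E = 0) (lam : ℝ) (d : ℕ) :
    ∀ t, t + d = E → 2 * lam * b t - lam ^ 2 * d ≤ 2 * (kap (lcs H t) : ℝ) := by
  induction d with
  | zero =>
    intro t ht
    have : t = E := by omega
    subst this
    rw [hE]; simp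
  | succ d ih =>
    intro t ht
    have h1 := ih (t + 1) (by omega)
    obtain ⟨h2, h3⟩ := lcs_step hp b hb t
    obtain ⟨w, hw⟩ := Nat.exists_eq_add_of_le h2
    have hw' : b t - b (t + 1) = w := by omega
    rw [hw'] at h3
    have h4 : w ^ 2 + 2 ≤ 2 * p ^ w :=
      (sq_le_pow2 w).trans (Nat.mul_le_mul_left _ (Nat.pow_le_pow_left hp.two_le w))
    have h5 : w ^ 2 + 2 * kap (lcs H (t + 1)) ≤ 2 * kap (lcs H t) := by omega
    have h5' : (w : ℝ) ^ 2 + 2 * kap (lcs H (t + 1)) ≤ 2 * kap (lcs H t) := by exact_mod_cast h5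
    have h6 : (b t : ℝ) = b (t + 1) + w := by exact_mod_cast hw
    rw [h6]
    push_cast
    nlinarith [sq_nonneg (w - lam)]

lemma window (b : ℕ → ℕ) (i E W T : ℕ) (hiE : i ≤ E) (hE : b E = 0) (hT : 1 ≤ T) (hTi : T ≤ b i)
    (hW : ∀ t, b t ≤ b (t + 1) + W) : ∃ t, i ≤ t ∧ t ≤ E ∧ T ≤ b t ∧ b t < T + W := by
  by_contra hcon
  push Not at hcon
  have : ∀ d, i + d ≤ E → T ≤ b (i + d) := by
    intro d
    induction d with
    | zero => intro _; exact hTi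
    | succ d ih =>
      intro hd
      have h1 := ih (by omega)
      have h2 := hcon (i + d) (by omega) (by omega) h1
      have h3 := hW (i + d)
      rw [← add_assoc]
      omega
  have h := this (E - i) (by omega)
  rw [Nat.add_sub_cancel' hiE, hE] at h
  omega

lemma core {p n : ℕ} (hp : p.Prime) (hH : Nat.card H = p ^ n) (b : ℕ → ℕ)
    (hb : ∀ t, Nat.card (lcs H t) = p ^ b t) (i E : ℕ) (hiE : i ≤ E) (hE2 : E ≤ 2 * i + 1)
    (hE : b E = 0) (lam : ℝ) (hlam : ∀ t, i ≤ t → t ≤ E → lam * (E - t) ≤ b t) (hl0 : 0 ≤ lam)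
    (W : ℕ) (hW0 : 1 ≤ W) (hW : ∀ t, b t ≤ b (t + 1) + W) (m : ℕ)
    (hm : ∀ k < m, 4 ^ k * W ≤ b i) (e : ℕ) :
    p ^ e * b i ≤ 2 * Nat.card (ConjClasses H) ∨
      (b i : ℝ) * m * lam ≤ 168 * e * Nat.card (ConjClasses H) := by
  set A := lcs H i with hAdef
  have hbot : lcs H E = ⊥ := by
    apply Subgroup.eq_bot_of_card_eq
    rw [hb, hE, pow_zero]
  have hA : Comm A := by
    intro a ha c hc
    have h1 : ⁅A, A⁆ ≤ lcs H E :=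
      (lcs_comm i i).trans (Subgroup.lowerCentralSeries_antitone _ (by omega))
    rw [hbot, le_bot_iff, Subgroup.commutator_eq_bot_iff_le_centralizer] at h1
    exact (Subgroup.mem_centralizer_iff.1 (h1 ha) c hc).symm
  obtain ⟨s, hs⟩ := card_pow_sub hp hH (powS A hA (p ^ (3 * e)))
  obtain ⟨r, hr⟩ := card_pow_sub hp hH (torsS A hA p)
  have hrank := card_rank hA p (3 * e)
  rw [hb, hr, hs, ← pow_mul, ← pow_add, Nat.pow_le_pow_iff_right hp.one_lt] at hrank
  by_cases hcase : b i ≤ 2 * s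
  · left
    have := lemT hp hH hA e s hs
    calc p ^ e * b i ≤ p ^ e * (2 * s) := Nat.mul_le_mul_left _ hcase
      _ = 2 * (p ^ e * s) := by ring
      _ ≤ _ := Nat.mul_le_mul_left _ this
  right
  have hr2 : b i ≤ 6 * e * r := by nlinarith
  have hwin : ∀ k, ∃ t, k < m → (i ≤ t ∧ t ≤ E ∧ 4 ^ k * W ≤ b t ∧ b t < 4 ^ k * W + W) := by
    intro k
    by_cases hk : k < m
    · obtain ⟨t, ht⟩ := window b i E W (4 ^ k * W) hiE hE
        (Nat.mul_pos (by positivity) hW0) (hm k hk) hW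
      exact ⟨t, fun _ => ht⟩
    · exact ⟨0, fun h => absurd h hk⟩
  choose τ hτ using hwin
  have hS := lemS hp hH hA r hr (fun k => lcs H (τ k)) (fun k => b (τ k)) m
    (fun k _ => inferInstance)
    (fun k hk => Subgroup.lowerCentralSeries_antitone _ (hτ k hk).1)
    (fun k _ => hb _)
    (fun k hk => by
      have h1 := (hτ k hk).2.2.1
      have h2 : 1 ≤ 4 ^ k * W := Nat.mul_pos (by positivity) hW0
      exact h2.trans h1)
    (fun k hk => by
      have h1 := (hτ k (by omega)).2.2.2
      have h2 := (hτ (k + 1) hk).2.2.1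
      have h3 : 1 ≤ 4 ^ k := Nat.one_le_pow _ _ (by norm_num)
      have h4 : W ≤ 4 ^ k * W := Nat.le_mul_of_pos_left _ h3
      rw [pow_succ] at h2
      have h5 : 4 ^ k * 4 * W = 4 * (4 ^ k * W) := by ring
      rw [h5] at h2
      show 2 * b (τ k) ≤ b (τ (k + 1))
      omega)
  have hterm : ∀ k ∈ Finset.range m, lam / 2 ≤ (kap (lcs H (τ k)) : ℝ) / b (τ k) := by
    intro k hk
    obtain ⟨h1, h2, h3, h4⟩ := hτ k (Finset.mem_range.1 hk)
    have h5 := kap_lcs hp b hb E hE lam (E - τ k) (τ k) (by omega)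
    have h6 := hlam (τ k) h1 h2
    have hbpos : 0 < b (τ k) := lt_of_lt_of_le (Nat.mul_pos (by positivity) hW0) h3
    have hbpos' : (0 : ℝ) < b (τ k) := by exact_mod_cast hbpos
    rw [Nat.cast_sub h2] at h5
    rw [div_le_div_iff₀ (by norm_num) hbpos']
    nlinarith [mul_le_mul_of_nonneg_left h6 hl0]
  have hsum := Finset.sum_le_sum hterm
  rw [Finset.sum_const, Finset.card_range, nsmul_eq_mul] at hsum
  have hr2' : (b i : ℝ) ≤ 6 * e * r := by exact_mod_cast hr2
  have h7 : (r : ℝ) * (m * (lam / 2)) ≤ 14 * Nat.card (ConjClasses H) :=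
    (mul_le_mul_of_nonneg_left hsum (by positivity)).trans hS
  calc (b i : ℝ) * m * lam = b i * (m * lam) := by ring
    _ ≤ (6 * e * r) * (m * lam) := by gcongr
    _ = 12 * e * (r * (m * (lam / 2))) := by ring
    _ ≤ 12 * e * (14 * Nat.card (ConjClasses H)) := by gcongr
    _ = _ := by ring

/-- The same statement for the whole group, passing to a quotient. -/
lemma core_quot {p : ℕ} (hp : p.Prime) (g : ℕ → ℕ)
    (hg : ∀ t, Nat.card (lcs H t) = p ^ g t) (i E : ℕ) (hiE : i ≤ E) (hE2 : E ≤ 2 * i + 1)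
    (lam : ℝ) (hlam : ∀ t, i ≤ t → t ≤ E → lam * (E - t) ≤ (g t : ℝ) - g E) (hl0 : 0 ≤ lam)
    (W : ℕ) (hW0 : 1 ≤ W) (hW : ∀ t, g t ≤ g (t + 1) + W) (m : ℕ)
    (hm : ∀ k < m, 4 ^ k * W ≤ g i - g E) (e : ℕ) :
    p ^ e * (g i - g E) ≤ 2 * Nat.card (ConjClasses H) ∨
      ((g i - g E : ℕ) : ℝ) * m * lam ≤ 168 * e * Nat.card (ConjClasses H) := by
  set N := lcs H E with hN
  set π := QuotientGroup.mk' N with hπ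
  have hanti : Antitone g := antitone_nat_of_succ_le fun t => (lcs_step hp g hg t).1
  have hmap : ∀ t, lcs (H ⧸ N) t = (lcs H t).map π := by
    intro t
    rw [Subgroup.map_lowerCentralSeries,
      Subgroup.map_top_of_surjective _ (QuotientGroup.mk'_surjective N)]
  have hcard : ∀ t, Nat.card (lcs (H ⧸ N) t) = p ^ (g t - g E) := by
    intro t
    rcases le_total t E with h | h
    · have h1 := card_map_mk (lcs H t) N (Subgroup.lowerCentralSeries_antitone _ h)
      rw [hg, hg, ← hπ, ← hmap t, ← Nat.add_sub_cancel' (hanti h), pow_add] at h1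
      have := Nat.eq_of_mul_eq_mul_left (pow_pos hp.pos _) h1
      rw [this]
    · have h1 : g t - g E = 0 := Nat.sub_eq_zero_of_le (hanti h)
      have h2 : (lcs H t).map π = ⊥ := by
        rw [Subgroup.map_eq_bot_iff, QuotientGroup.ker_mk']
        exact Subgroup.lowerCentralSeries_antitone _ h
      rw [hmap, h2, h1]; simp
  have hcQ : Nat.card (H ⧸ N) = p ^ (g 0 - g E) := by
    rw [← hcard 0]
    change _ = Nat.card (⊤ : Subgroup (H ⧸ N))
    simp
  have hk := k_quot N
  have hk' : (Nat.card (ConjClasses (H ⧸ N)) : ℝ) ≤ Nat.card (ConjClasses H) := by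
    exact_mod_cast hk
  have hc := core hp hcQ (fun t => g t - g E) hcard i E hiE hE2 (Nat.sub_self _) lam (by
      intro t h1 h2
      have := hlam t h1 h2
      show lam * (E - t) ≤ ((g t - g E : ℕ) : ℝ)
      rwa [Nat.cast_sub (hanti h2)]) hl0 W hW0 (by
      intro t
      have := hW t
      show g t - g E ≤ g (t + 1) - g E + W
      omega) m hm e
  rcases hc with h | h
  · left; exact h.trans (Nat.mul_le_mul_left _ hk)
  · right
    refine h.trans ?_
    gcongr

end Core

section Selection

lemma exists_block (n : ℕ) (hn : 1 ≤ n) (g : ℕ → ℕ) (hg : Antitone g) (h0 : g 0 = n)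
    (hgn : g n = 0) :
    ∃ j : ℕ, (n : ℝ) * 2 ^ j ≤ 16 * ((g (2 ^ j - 1) : ℝ) - g (2 ^ (j + 1) - 1)) ^ 2 := by
  by_contra hcon
  push Not at hcon
  set q := Real.sqrt 2 with hq
  have hq2 : q ^ 2 = 2 := Real.sq_sqrt (by norm_num)
  have hq0 : 0 < q := Real.sqrt_pos.2 (by norm_num)
  set N := Real.sqrt n with hN
  have hn' : (1 : ℝ) ≤ n := by exact_mod_cast hn
  have hN2 : N ^ 2 = n := Real.sq_sqrt (by positivity)
  have hN0 : 0 < N := Real.sqrt_pos.2 (by linarith)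
  set L := Nat.log 2 n with hL
  have hL1 : 2 ^ L ≤ n := Nat.pow_log_le_self 2 (by omega)
  have hL2 : n < 2 ^ (L + 1) := Nat.lt_pow_succ_log_self (by norm_num) n
  have hterm : ∀ j ∈ Finset.range (L + 1),
      ((g (2 ^ j - 1) : ℝ) - g (2 ^ (j + 1) - 1)) ≤ N / 4 * q ^ j := by
    intro j _
    have h1 := hcon j
    refine abs_le_of_sq_le_sq' ?_ (by positivity) |>.2
    have : (N / 4 * q ^ j) ^ 2 = n * 2 ^ j / 16 := by
      rw [mul_pow, div_pow, hN2, ← pow_mul, mul_comm j 2, pow_mul, hq2]; ring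
    rw [this]; linarith
  have hsum := Finset.sum_le_sum hterm
  rw [Finset.sum_range_sub' (fun j => (g (2 ^ j - 1) : ℝ)), ← Finset.mul_sum] at hsum
  have hz : g (2 ^ (L + 1) - 1) = 0 := by
    have := hg (show n ≤ 2 ^ (L + 1) - 1 by omega)
    omega
  rw [hz] at hsum
  simp only [pow_zero, Nat.sub_self, h0, Nat.cast_zero, sub_zero] at hsum
  have hgeo := geom_sum_mul q (L + 1)
  have hqL : q ^ L ≤ N := by
    refine abs_le_of_sq_le_sq' ?_ hN0.le |>.2
    rw [hN2, ← pow_mul, mul_comm L 2, pow_mul, hq2]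
    exact_mod_cast hL1
  have hq1 : 4 / 3 < q := by
    rw [hq]; apply Real.lt_sqrt_of_sq_lt; norm_num
  have h5 : (n : ℝ) * (q - 1) ≤ N / 4 * (q ^ (L + 1) - 1) := by
    rw [← hgeo, ← mul_assoc]
    exact mul_le_mul_of_nonneg_right hsum (by linarith)
  have h6 : q ^ (L + 1) ≤ N * q := by
    rw [pow_succ]; exact mul_le_mul_of_nonneg_right hqL hq0.le
  have h7 : N / 4 * (q ^ (L + 1) - 1) ≤ N / 4 * (N * q) := by
    apply mul_le_mul_of_nonneg_left _ (by positivity)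
    linarith
  have h8 : N / 4 * (N * q) = n * q / 4 := by rw [← hN2]; ring
  nlinarith

lemma selection (n : ℕ) (hn : 1 ≤ n) (g : ℕ → ℕ) (hg : Antitone g) (h0 : g 0 = n)
    (hgn : g n = 0) :
    ∃ (i E : ℕ) (lam : ℝ), i ≤ E ∧ E ≤ 2 * i + 1 ∧ 0 ≤ lam ∧
      (∀ t, i ≤ t → t ≤ E → lam * (E - t) ≤ (g t : ℝ) - g E) ∧
      (n : ℝ) ≤ 64 * ((g i : ℝ) - g E) * lam := by
  obtain ⟨j, hj⟩ := exists_block n hn g hg h0 hgn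
  set i := 2 ^ j - 1 with hi
  have hpos : 1 ≤ 2 ^ j := Nat.one_le_two_pow
  have hi' : 2 ^ (j + 1) - 1 = 2 * i + 1 := by rw [pow_succ]; omega
  rw [hi'] at hj
  set a : ℝ := (g i : ℝ) - g (2 * i + 1) with ha
  have ha0 : 0 ≤ a := by
    have := hg (show i ≤ 2 * i + 1 by omega)
    have : (g (2 * i + 1) : ℝ) ≤ g i := by exact_mod_cast this
    linarith
  set Q : ℝ := 2 ^ j with hQ
  have hQ0 : 0 < Q := by positivity
  have hiQ : (i : ℝ) + 1 = Q := by
    rw [hi, hQ]; push_cast [hpos]; ring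
  set lam : ℝ := a / (2 * Q) with hlam
  have hl0 : 0 ≤ lam := by positivity
  have hla : lam * Q = a / 2 := by rw [hlam]; field_simp
  obtain ⟨E, hE, hmin⟩ := Finset.exists_min_image (Finset.Icc i (2 * i + 1))
    (fun t => (g t : ℝ) + lam * t) ⟨i, by simp; omega⟩
  rw [Finset.mem_Icc] at hE
  refine ⟨i, E, lam, hE.1, hE.2, hl0, ?_, ?_⟩
  · intro t h1 h2
    have := hmin t (Finset.mem_Icc.2 ⟨h1, h2.trans hE.2⟩)
    linarith
  · have h1 := hmin (2 * i + 1) (Finset.mem_Icc.2 ⟨by omega, le_rfl⟩)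
    push_cast at h1
    have h2 : lam * i ≤ lam * E := mul_le_mul_of_nonneg_left (by exact_mod_cast hE.1) hl0
    have h3 : lam * Q ≤ (g i : ℝ) - g E := by
      have h4 : lam * (2 * i + 1) = lam * i + lam * Q := by rw [← hiQ]; ring
      linarith
    have h5 : (lam * Q) * lam ≤ ((g i : ℝ) - g E) * lam := mul_le_mul_of_nonneg_right h3 hl0
    have h6 : (n : ℝ) ≤ 64 * ((lam * Q) * lam) := by
      have : 64 * ((lam * Q) * lam) = 16 * a ^ 2 / Q := by
        rw [hlam]; field_simp; ring
      rw [this, le_div_iff₀ hQ0]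
      exact hj
    linarith

end Selection

section Final
variable {G : Type} [Group G] [Finite G]

lemma lcs_strict {p n : ℕ} (hp : p.Prime) (hG : Nat.card G = p ^ n) (g : ℕ → ℕ)
    (hg : ∀ t, Nat.card (lcs G t) = p ^ g t) (t : ℕ) (ht : 0 < g t) : g (t + 1) < g t := by
  rcases (lcs_step hp g hg t).1.lt_or_eq with h | h
  · exact h
  exfalso
  have h1 : lcs G (t + 1) ≤ lcs G t := Subgroup.lowerCentralSeries_antitone _ (Nat.le_succ t)
  have h2 : (lcs G (t + 1) : Set G) = lcs G t := Set.eq_of_subset_of_ncard_le h1 (by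
    rw [← Nat.card_coe_set_eq, ← Nat.card_coe_set_eq]
    exact (((hg t).trans (by rw [h])).trans (hg (t + 1)).symm).le) (Set.toFinite _)
  have h3 : lcs G t ≤ ⁅lcs G t, (⊤ : Subgroup G)⁆ ⊔ ⊥ := by
    rw [sup_bot_eq]; exact h2.ge
  have h4 := comm_lt hp hG (lcs G t) ⊥ bot_le h3
  have h5 := hg t
  rw [h4] at h5
  have h6 : p ^ 0 = p ^ g t := by rw [← h5]; simp
  have := Nat.pow_right_injective hp.two_le h6
  omega

lemma lcs_end {p n : ℕ} (hp : p.Prime) (hG : Nat.card G = p ^ n) (g : ℕ → ℕ)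
    (hg : ∀ t, Nat.card (lcs G t) = p ^ g t) : g 0 = n ∧ g n = 0 := by
  have h0 : g 0 = n := by
    have h1 := hg 0
    have h2 : Nat.card (lcs G 0) = p ^ n := by
      rw [← hG]
      change Nat.card (⊤ : Subgroup G) = _
      simp
    exact Nat.pow_right_injective hp.two_le (h1.symm.trans h2)
  refine ⟨h0, ?_⟩
  have : ∀ t, g t ≤ n - t := by
    intro t
    induction t with
    | zero => rw [h0]; omega
    | succ t ih =>
      rcases Nat.eq_zero_or_pos (g t) with h | h
      · have := (lcs_step hp g hg t).1
        omega
      · have := lcs_strict hp hG g hg t h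
        omega
  have := this n
  omega

lemma lcs_width {p : ℕ} (hp : p.Prime) (g : ℕ → ℕ)
    (hg : ∀ t, Nat.card (lcs G t) = p ^ g t) (t : ℕ) :
    p ^ (g t - g (t + 1)) ≤ Nat.card (ConjClasses G) := by
  have h1 := (lcs_step hp g hg t).2
  have h2 : kap (⊥ : Subgroup G) ≤ kap (lcs G (t + 1)) := kap_mono bot_le
  have h3 : kap (lcs G t) ≤ kap (⊤ : Subgroup G) := kap_mono le_top
  rw [kap_bot] at h2
  rw [kap_top] at h3
  omega

lemma numb (h : ℕ) (hh : 20 ≤ h) : 256 * (2 * h + 1) ^ 2 ≤ 2 ^ h := by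
  induction h, hh using Nat.le_induction with
  | base => norm_num
  | succ h hh ih =>
    rw [pow_succ 2 h]
    nlinarith

lemma main_bound {p n : ℕ} (hp : p.Prime) (hG : Nat.card G = p ^ n) (hn : p ^ p < n)
    (L l : ℝ) (hL : L = Real.logb p n) (hl : l = Real.logb p L) :
    (1 / 10 ^ 6 : ℝ) * n * L / l < Nat.card (ConjClasses G) := by
  set K := Nat.card (ConjClasses G) with hK
  have hp2 : (2 : ℝ) ≤ p := by exact_mod_cast hp.two_le
  have hp1 : (1 : ℝ) < p := by linarith
  have hp0 : (0 : ℝ) < p := by linarith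
  have hn4 : 4 < n := by
    have : 2 ^ 2 ≤ p ^ p := (Nat.pow_le_pow_left hp.two_le 2).trans
      (Nat.pow_le_pow_right hp.pos hp.two_le)
    omega
  have hn0 : (0 : ℝ) < n := by exact_mod_cast (by omega : 0 < n)
  have hpL : (p : ℝ) ^ L = n := by rw [hL]; exact Real.rpow_logb hp0 hp1.ne' hn0
  have hLp : (p : ℝ) < L := by
    rw [hL, Real.lt_logb_iff_rpow_lt hp1 hn0, Real.rpow_natCast]
    exact_mod_cast hn
  have hL0 : 0 < L := by linarith
  have hpl : (p : ℝ) ^ l = L := by rw [hl]; exact Real.rpow_logb hp0 hp1.ne' hL0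
  have hl1 : 1 < l := by
    rw [hl, Real.lt_logb_iff_rpow_lt hp1 hL0, Real.rpow_one]
    exact hLp
  have hl0 : 0 < l := by linarith
  have hK1 : (n : ℝ) < K := by
    have := k_ge hp hG
    exact_mod_cast (by omega : n < K)
  set μ := Nat.log 2 n with hμ
  have hμ1 : 2 ^ μ ≤ n := Nat.pow_log_le_self 2 (by omega)
  have hμ2 : n < 2 ^ (μ + 1) := Nat.lt_pow_succ_log_self (by norm_num) n
  have hLμ : L ≤ μ + 1 := by
    rw [hL, Real.logb_le_iff_le_rpow hp1 hn0]
    have h1 : (n : ℝ) ≤ 2 ^ (μ + 1) := by exact_mod_cast hμ2.le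
    have h2 : (2 : ℝ) ^ (μ + 1) ≤ (p : ℝ) ^ (μ + 1) := pow_le_pow_left₀ (by norm_num) hp2 _
    have h3 : (p : ℝ) ^ ((μ : ℝ) + 1) = (p : ℝ) ^ (μ + 1) := by
      rw [← Real.rpow_natCast]; push_cast; rfl
    rw [h3]; linarith
  rw [div_lt_iff₀ hl0]
  by_cases hbig : μ < 40
  · have h1 : (μ : ℝ) + 1 ≤ 40 := by exact_mod_cast hbig
    have h2 : (1 / 10 ^ 6 : ℝ) * n * L ≤ (1 / 10 ^ 6 : ℝ) * n * 40 := by gcongr; linarith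
    have h3 : (n : ℝ) * 1 ≤ K * l := mul_le_mul hK1.le hl1.le (by norm_num) (by linarith)
    linarith
  push Not at hbig
  by_cases hKn : n ^ 2 < K
  · have h1 : (n : ℝ) ^ 2 < K := by exact_mod_cast hKn
    have h2 : μ + 1 ≤ n := by
      have := Nat.lt_two_pow_self (n := μ)
      omega
    have h2' : (μ : ℝ) + 1 ≤ n := by exact_mod_cast h2
    have h3 : (1 / 10 ^ 6 : ℝ) * n * L ≤ 1 * n * n := by
      gcongr
      · norm_num
      · linarith
    have h4 : (K : ℝ) * 1 ≤ K * l := by gcongr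
    nlinarith
  push Not at hKn
  choose g hg using fun t => card_pow_sub hp hG (lcs G t)
  obtain ⟨hg0, hgn⟩ := lcs_end hp hG g hg
  have hanti : Antitone g := antitone_nat_of_succ_le fun t => (lcs_step hp g hg t).1
  have hwid : ∀ t, ((g t - g (t + 1) : ℕ) : ℝ) ≤ 2 * L := by
    intro t
    have h1 := (lcs_width hp g hg t).trans hKn
    have h2 : (p : ℝ) ^ (g t - g (t + 1)) ≤ (n : ℝ) ^ 2 := by exact_mod_cast h1
    have h3 : (n : ℝ) ^ 2 = (p : ℝ) ^ (2 * L) := by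
      rw [mul_comm, Real.rpow_mul hp0.le, hpL]; norm_cast
    rw [h3, ← Real.rpow_natCast] at h2
    exact (Real.rpow_le_rpow_left_iff hp1).1 h2
  set W := ⌊2 * L⌋₊ with hW
  have hWL : (W : ℝ) ≤ 2 * L := Nat.floor_le (by linarith)
  have hW1 : 1 ≤ W := Nat.le_floor (by push_cast; linarith)
  have hwW : ∀ t, g t ≤ g (t + 1) + W := by
    intro t
    have : g t - g (t + 1) ≤ W := Nat.le_floor (hwid t)
    omega
  obtain ⟨i, E, lam, hiE, hE2, hlam0, hlam, hsel⟩ := selection n (by omega) g hanti hg0 hgn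
  set a := g i - g E with ha
  have haR : (a : ℝ) = (g i : ℝ) - g E := Nat.cast_sub (hanti hiE)
  rw [← haR] at hsel
  have hlt : i < E := by
    rcases hiE.lt_or_eq with h | h
    · exact h
    · exfalso
      have : a = 0 := by rw [ha, h]; omega
      rw [this] at hsel
      simp at hsel
      omega
  have hlamL : lam ≤ 2 * L := by
    have h1 := hlam (E - 1) (by omega) (by omega)
    have h2 := hwid (E - 1)
    rw [Nat.sub_add_cancel (by omega : 1 ≤ E)] at h2
    rw [Nat.cast_sub (hanti (by omega))] at h2
    have h3 : ((E - 1 : ℕ) : ℝ) = E - 1 := by push_cast [(by omega : 1 ≤ E)]; ring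
    rw [h3] at h1
    linarith
  have haL : (n : ℝ) ≤ 128 * L * a := by
    have : 64 * (a : ℝ) * lam ≤ 64 * (a : ℝ) * (2 * L) := by gcongr
    linarith
  set m := μ / 4 with hm
  have hm5 : L ≤ 5 * m := by
    have h1 : μ + 1 ≤ 5 * m := by omega
    have h2 : (μ : ℝ) + 1 ≤ 5 * m := by exact_mod_cast h1
    linarith
  have hmn : 4 ^ m * (256 * (μ + 1) ^ 2) ≤ n := by
    have h1 := numb (μ - 2 * m) (by omega)
    have h2 : μ + 1 ≤ 2 * (μ - 2 * m) + 1 := by omega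
    calc 4 ^ m * (256 * (μ + 1) ^ 2) ≤ 4 ^ m * (256 * (2 * (μ - 2 * m) + 1) ^ 2) := by gcongr
      _ ≤ 4 ^ m * 2 ^ (μ - 2 * m) := Nat.mul_le_mul_left _ h1
      _ = 2 ^ μ := by
        rw [show (4 : ℕ) = 2 ^ 2 by norm_num, ← pow_mul, ← pow_add]
        congr 1; omega
      _ ≤ n := hμ1
  have hmk : ∀ k < m, 4 ^ k * W ≤ a := by
    intro k hk
    have h1 : (4 : ℝ) ^ k * W ≤ a := by
      have h2 : (4 : ℝ) ^ m * (256 * ((μ : ℝ) + 1) ^ 2) ≤ n := by exact_mod_cast hmn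
      have h3 : (4 : ℝ) ^ k ≤ 4 ^ m := pow_le_pow_right₀ (by norm_num) hk.le
      have h4 : (4 : ℝ) ^ k * (256 * L ^ 2) ≤ 4 ^ m * (256 * ((μ : ℝ) + 1) ^ 2) := by gcongr
      have h5 : 128 * L * ((4 : ℝ) ^ k * (2 * L)) ≤ 128 * L * a := by
        calc 128 * L * ((4 : ℝ) ^ k * (2 * L)) = (4 : ℝ) ^ k * (256 * L ^ 2) := by ring
          _ ≤ 128 * L * a := by linarith
      have h6 := le_of_mul_le_mul_left h5 (by positivity)
      calc (4 : ℝ) ^ k * W ≤ (4 : ℝ) ^ k * (2 * L) := by gcongr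
        _ ≤ a := h6
    exact_mod_cast h1
  set e := ⌈2 * l⌉₊ with he
  have he1 : (e : ℝ) ≤ 3 * l := by
    have := Nat.ceil_lt_add_one (show 0 ≤ 2 * l by linarith)
    linarith
  have he2 : L ^ 2 ≤ (p : ℝ) ^ e := by
    have h1 : 2 * l ≤ e := Nat.le_ceil _
    calc L ^ 2 = ((p : ℝ) ^ l) ^ 2 := by rw [hpl]
      _ = (p : ℝ) ^ (2 * l) := by
        rw [mul_comm, Real.rpow_mul hp0.le]; norm_cast
      _ ≤ (p : ℝ) ^ (e : ℝ) := Real.rpow_le_rpow_of_exponent_le hp1.le h1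
      _ = _ := Real.rpow_natCast _ _
  have hnL : 0 < (n : ℝ) * L := by positivity
  rcases core_quot hp g hg i E hiE hE2 lam hlam hlam0 W hW1 hwW m hmk e with h | h
  · have h1 : (p : ℝ) ^ e * a ≤ 2 * K := by exact_mod_cast h
    have h2 : L ^ 2 * a ≤ (p : ℝ) ^ e * a := by gcongr
    have h3 : (n : ℝ) * L ≤ 128 * (L ^ 2 * a) := by
      calc (n : ℝ) * L ≤ (128 * L * a) * L := by gcongr
        _ = _ := by ring
    have h4 : (K : ℝ) * 1 ≤ K * l := by gcongr
    nlinarith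
  · change (a : ℝ) * m * lam ≤ 168 * e * K at h
    have h1 : (n : ℝ) * m ≤ 64 * (168 * e * K) := by
      calc (n : ℝ) * m ≤ (64 * (a : ℝ) * lam) * m := by gcongr
        _ = 64 * (a * m * lam) := by ring
        _ ≤ _ := by gcongr
    have h2 : (n : ℝ) * L ≤ n * (5 * m) := by gcongr
    have h3 : (64 : ℝ) * (168 * e * K) ≤ 64 * (168 * (3 * l) * K) := by gcongr
    nlinarith

end Final

end PGrp

theorem stmt15 :
    ∃ c : ℝ, 0 < c ∧
      ∀ (p : ℕ), p.Prime →
        ∀ (G : Type) [Group G] [Finite G], IsPGroup p G →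
          p ^ p ^ p < Nat.card G →
          c * Real.logb p (Nat.card G) *
              Real.logb p (Real.logb p (Nat.card G)) /
              Real.logb p (Real.logb p (Real.logb p (Nat.card G)))
            < (Nat.card (ConjClasses G) : ℝ) := by
  refine ⟨1 / 10 ^ 6, by norm_num, ?_⟩
  intro p hp G _ _ hG hcard
  haveI : Fact p.Prime := ⟨hp⟩
  obtain ⟨n, hn⟩ := IsPGroup.iff_card.1 hG
  have h1 : p ^ p < n := by
    rw [hn] at hcard
    exact (Nat.pow_lt_pow_iff_right hp.one_lt).1 hcard
  have h2 : Real.logb p (Nat.card G) = n := by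
    rw [hn]
    push_cast
    rw [← Real.rpow_natCast]
    exact Real.logb_rpow (by exact_mod_cast hp.pos) (by exact_mod_cast hp.one_lt.ne')
  rw [h2]
  exact PGrp.main_bound hp hn h1 _ _ rfl rfl
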